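/- arXiv:2604.05670 — 3 statements merged into one kernel-verified Lean document; each statement's English description precedes it below -/
import Mathlib

section
/- Let θ > 0 and let f be a probability density on ℝ that is everywhere positive and log-concave. Define ρ(z) = ∫_{−∞}^0 f(s − θz) ds, κ(x) = ∫_0^∞ f(z − θx) ρ(z) dz and h(x) = κ(x)^{−1} ∫_0^∞ f(z − θx) κ(z) dz. Then the map z ↦ κ(z)/ρ(z) is non-decreasing on [0,∞), and the function h is non-decreasing on [0,∞). -/
open MeasureTheory Set

/-- Comparison of products of integrals from a pointwise comparison of products. -/
lemma integral_mul_integral_le_of_ae_le {α β : Type*} [MeasurableSpace α] [MeasurableSpace β]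
    {μ : Measure α} {ν : Measure β} [SFinite μ] [SFinite ν] {a c : α → ℝ} {b d : β → ℝ}
    (ha : Integrable a μ) (hb : Integrable b ν) (hc : Integrable c μ) (hd : Integrable d ν)
    (h : ∀ᵐ p ∂μ.prod ν, a p.1 * b p.2 ≤ c p.1 * d p.2) :
    (∫ x, a x ∂μ) * ∫ y, b y ∂ν ≤ (∫ x, c x ∂μ) * ∫ y, d y ∂ν := by
  rw [← integral_prod_mul, ← integral_prod_mul]
  exact integral_mono_ae (ha.mul_prod hb) (hc.mul_prod hd) h

/-- Comparison of products of integrals from a pointwise comparison of symmetrized products. -/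
lemma integral_mul_integral_le_of_ae_symm_le {α : Type*} [MeasurableSpace α]
    {μ : Measure α} [SFinite μ] {a b c d : α → ℝ}
    (ha : Integrable a μ) (hb : Integrable b μ) (hc : Integrable c μ) (hd : Integrable d μ)
    (h : ∀ᵐ p ∂μ.prod μ, a p.1 * b p.2 + b p.1 * a p.2 ≤ c p.1 * d p.2 + d p.1 * c p.2) :
    (∫ x, a x ∂μ) * ∫ y, b y ∂μ ≤ (∫ x, c x ∂μ) * ∫ y, d y ∂μ := by
  have key := integral_mono_ae ((ha.mul_prod hb).add (hb.mul_prod ha))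
    ((hc.mul_prod hd).add (hd.mul_prod hc)) h
  simp only [Pi.add_apply] at key
  rw [integral_add (ha.mul_prod hb) (hb.mul_prod ha),
    integral_add (hc.mul_prod hd) (hd.mul_prod hc)] at key
  simp only [integral_prod_mul] at key
  linarith [mul_comm (∫ x, a x ∂μ) (∫ x, b x ∂μ), mul_comm (∫ x, c x ∂μ) (∫ x, d x ∂μ)]

/-- A positive log-concave function on `ℝ` gives less weight to spread-out pairs. -/
lemma mul_le_mul_of_logConcave {f : ℝ → ℝ} (hfpos : ∀ x, 0 < f x)
    (hlc : ∀ x y l : ℝ, 0 ≤ l → l ≤ 1 → f x ^ l * f y ^ (1 - l) ≤ f (l * x + (1 - l) * y))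
    {a b c d : ℝ} (hab : a ≤ b) (hbd : b ≤ d) (hsum : a + d = b + c) :
    f a * f d ≤ f b * f c := by
  rcases (hab.trans hbd).eq_or_lt with had | had
  · obtain rfl : b = a := by linarith
    obtain rfl : c = d := by linarith
    rfl
  have hda : 0 < d - a := sub_pos.2 had
  set l := (d - b) / (d - a) with hl
  have hl0 : 0 ≤ l := div_nonneg (by linarith) hda.le
  have hl1 : l ≤ 1 := (div_le_one hda).2 (by linarith)
  have hb : l * a + (1 - l) * d = b := by rw [hl]; field_simp; ring
  have hc : l * d + (1 - l) * a = c := by linarith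
  have h₁ := hlc a d l hl0 hl1
  have h₂ := hlc d a l hl0 hl1
  rw [hb] at h₁
  rw [hc] at h₂
  have split : ∀ x, f x ^ l * f x ^ (1 - l) = f x := fun x => by
    rw [← Real.rpow_add (hfpos x), add_sub_cancel, Real.rpow_one]
  calc f a * f d = (f a ^ l * f a ^ (1 - l)) * (f d ^ l * f d ^ (1 - l)) := by
        rw [split, split]
    _ = (f a ^ l * f d ^ (1 - l)) * (f d ^ l * f a ^ (1 - l)) := by ring
    _ ≤ f b * f c := mul_le_mul h₁ h₂
        (mul_nonneg (Real.rpow_nonneg (hfpos _).le _) (Real.rpow_nonneg (hfpos _).le _))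
        (hfpos _).le

/-- A positive log-concave function on `ℝ` is continuous. -/
lemma continuous_of_logConcave {f : ℝ → ℝ} (hfpos : ∀ x, 0 < f x)
    (hlc : ∀ x y l : ℝ, 0 ≤ l → l ≤ 1 → f x ^ l * f y ^ (1 - l) ≤ f (l * x + (1 - l) * y)) :
    Continuous f := by
  have hconc : ConcaveOn ℝ univ (fun x => Real.log (f x)) := by
    refine ⟨convex_univ, fun x _ y _ a b ha hb hab => ?_⟩
    obtain rfl : b = 1 - a := by linarith
    have h := Real.log_le_log
      (mul_pos (Real.rpow_pos_of_pos (hfpos x) _) (Real.rpow_pos_of_pos (hfpos y) _))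
      (hlc x y a ha (by linarith))
    rw [Real.log_mul (Real.rpow_pos_of_pos (hfpos x) _).ne'
      (Real.rpow_pos_of_pos (hfpos y) _).ne', Real.log_rpow (hfpos x),
      Real.log_rpow (hfpos y)] at h
    exact h
  have hlog : Continuous (fun x => Real.log (f x)) :=
    continuousOn_univ.1 (hconc.continuousOn isOpen_univ)
  simpa only [Function.comp_def, Real.exp_log (hfpos _)] using Real.continuous_exp.comp hlog

/-- The integral over `Ioi 0` of a translated probability density against a measurable weight
with values in `[0, 1]` depends measurably on the translation and stays in `[0, 1]`. -/
lemma measurable_and_mem_Icc_integral_translate {θ : ℝ} {f g : ℝ → ℝ} (hf : Measurable f)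
    (hfpos : ∀ x, 0 < f x) (hprob : ∫ x, f x = 1) (hg : Measurable g)
    (hg01 : ∀ x, g x ∈ Icc (0 : ℝ) 1) :
    Measurable (fun z => ∫ w in Ioi (0 : ℝ), f (w - θ * z) * g w) ∧
      ∀ z, ∫ w in Ioi (0 : ℝ), f (w - θ * z) * g w ∈ Icc (0 : ℝ) 1 := by
  have hint : Integrable f := .of_integral_ne_zero (by simp [hprob])
  refine ⟨?_, fun z => ⟨integral_nonneg fun w => mul_nonneg (hfpos _).le (hg01 w).1, ?_⟩⟩
  · have hm : Measurable (fun p : ℝ × ℝ => f (p.2 - θ * p.1) * g p.2) := by fun_prop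
    exact hm.stronglyMeasurable.integral_prod_right'.measurable
  · have hz : Integrable (fun w => f (w - θ * z)) := hint.comp_sub_right _
    calc ∫ w in Ioi (0 : ℝ), f (w - θ * z) * g w
        ≤ ∫ w in Ioi (0 : ℝ), f (w - θ * z) :=
          integral_mono_of_nonneg
            (.of_forall fun w => mul_nonneg (hfpos _).le (hg01 w).1) hz.integrableOn
            (.of_forall fun w => mul_le_of_le_one_right (hfpos _).le (hg01 w).2)
      _ ≤ ∫ w, f (w - θ * z) :=
          setIntegral_le_integral hz (.of_forall fun w => (hfpos _).le)
      _ = 1 := by rw [integral_sub_right_eq_self, hprob]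

/-- Let `θ > 0` and `f` be an everywhere positive, log-concave
probability density on `ℝ`. With `ρ(z) = ∫_{-∞}^0 f(s - θz) ds`,
`κ(x) = ∫_0^∞ f(z - θx) ρ(z) dz` and `h(x) = κ(x)⁻¹ ∫_0^∞ f(z - θx) κ(z) dz`,
the map `z ↦ κ(z)/ρ(z)` is non-decreasing on `[0,∞)` and `h` is non-decreasing
on `[0,∞)`. -/
theorem kappa_rho_ratio_and_h_monotone
    (θ : ℝ) (hθ : 0 < θ)
    (f : ℝ → ℝ) (hfpos : ∀ x, 0 < f x)
    (hprob : ∫ x, f x = 1)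
    (hlc : ∀ x y l : ℝ, 0 ≤ l → l ≤ 1 → f x ^ l * f y ^ (1 - l) ≤ f (l * x + (1 - l) * y)) :
    MonotoneOn
        (fun z : ℝ =>
          (∫ w in Ioi (0 : ℝ), f (w - θ * z) * ∫ s in Iio (0 : ℝ), f (s - θ * w)) /
            ∫ s in Iio (0 : ℝ), f (s - θ * z))
        (Ici (0 : ℝ)) ∧
      MonotoneOn
        (fun x : ℝ =>
          (∫ w in Ioi (0 : ℝ), f (w - θ * x) *
              ∫ u in Ioi (0 : ℝ), f (u - θ * w) * ∫ s in Iio (0 : ℝ), f (s - θ * u)) /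
            ∫ w in Ioi (0 : ℝ), f (w - θ * x) * ∫ s in Iio (0 : ℝ), f (s - θ * w))
        (Ici (0 : ℝ)) := by
  have hcont := continuous_of_logConcave hfpos hlc
  have hfm : Measurable f := hcont.measurable
  have hint : Integrable f := .of_integral_ne_zero (by simp [hprob])
  have hint_tr : ∀ z, Integrable (fun w => f (w - θ * z)) := fun z => hint.comp_sub_right _
  set ρ : ℝ → ℝ := fun z => ∫ s in Iio (0 : ℝ), f (s - θ * z)
  set κ : ℝ → ℝ := fun z => ∫ w in Ioi (0 : ℝ), f (w - θ * z) * ρ w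
  have hρpos : ∀ z, 0 < ρ z := fun z => by
    refine (setIntegral_pos_iff_support_of_nonneg_ae (.of_forall fun s => (hfpos _).le)
      (hint_tr z).integrableOn).2 ?_
    rw [Function.support_eq_univ fun s => (hfpos _).ne']
    simp
  have hρ01 : ∀ z, ρ z ∈ Icc (0 : ℝ) 1 := fun z => by
    refine ⟨(hρpos z).le, (setIntegral_le_integral (hint_tr z)
      (.of_forall fun w => (hfpos _).le)).trans_eq ?_⟩
    rw [integral_sub_right_eq_self, hprob]
  have hρm : Measurable ρ := by
    have hm : Measurable (fun p : ℝ × ℝ => f (p.2 - θ * p.1)) := by fun_prop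
    exact hm.stronglyMeasurable.integral_prod_right'.measurable
  obtain ⟨hκm, hκ01⟩ : Measurable κ ∧ ∀ z, κ z ∈ Icc (0 : ℝ) 1 :=
    measurable_and_mem_Icc_integral_translate hfm hfpos hprob hρm hρ01
  have hint_mul : ∀ (g : ℝ → ℝ) (z : ℝ), Measurable g → (∀ x, g x ∈ Icc (0 : ℝ) 1) →
      IntegrableOn (fun w => f (w - θ * z) * g w) (Ioi 0) := fun g z hg hg01 =>
    (hint_tr z).integrableOn.mul_bdd (c := 1) hg.aestronglyMeasurable
      (.of_forall fun x => by rw [Real.norm_eq_abs, abs_of_nonneg (hg01 x).1]; exact (hg01 x).2)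
  have hκpos : ∀ z, 0 < κ z := fun z => by
    refine (setIntegral_pos_iff_support_of_nonneg_ae
      (.of_forall fun s => (mul_pos (hfpos _) (hρpos _)).le) (hint_mul ρ z hρm hρ01)).2 ?_
    rw [Function.support_eq_univ fun s => (mul_pos (hfpos _) (hρpos _)).ne']
    simp
  have tp : ∀ {x y s w : ℝ}, x ≤ y → s ≤ w →
      f (w - θ * x) * f (s - θ * y) ≤ f (w - θ * y) * f (s - θ * x) := fun {x y s w} hxy hsw => by
    have hθxy := mul_le_mul_of_nonneg_left hxy hθ.le
    rw [mul_comm]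
    exact mul_le_mul_of_logConcave hfpos hlc (by linarith) (by linarith) (by ring)
  have ratio : MonotoneOn (fun z => κ z / ρ z) (Ici 0) := by
    intro x _ y _ hxy
    refine (div_le_div_iff₀ (hρpos x) (hρpos y)).2 ?_
    refine integral_mul_integral_le_of_ae_le (hint_mul ρ x hρm hρ01) (hint_tr y).integrableOn
      (hint_mul ρ y hρm hρ01) (hint_tr x).integrableOn ?_
    rw [Measure.prod_restrict]
    refine ae_restrict_of_forall_mem (measurableSet_Ioi.prod measurableSet_Iio) fun p hp => ?_
    have h := mul_le_mul_of_nonneg_right (tp hxy ((mem_Iio.1 hp.2).trans (mem_Ioi.1 hp.1)).le)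
      (hρpos p.1).le
    linarith
  refine ⟨ratio, fun x _ y _ hxy => (div_le_div_iff₀ (hκpos x) (hκpos y)).2 ?_⟩
  refine integral_mul_integral_le_of_ae_symm_le (hint_mul κ x hκm hκ01) (hint_mul ρ y hρm hρ01)
    (hint_mul κ y hκm hκ01) (hint_mul ρ x hρm hρ01) ?_
  rw [Measure.prod_restrict]
  refine ae_restrict_of_forall_mem (measurableSet_Ioi.prod measurableSet_Ioi) fun p hp => ?_
  have cross : ∀ {v w : ℝ}, 0 < v → v ≤ w → κ v * ρ w ≤ κ w * ρ v := fun {v w} hv hvw =>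
    (div_le_div_iff₀ (hρpos v) (hρpos w)).1 (ratio hv.le (hv.le.trans hvw) hvw)
  rcases le_total p.1 p.2 with hle | hle
  · linarith [mul_nonneg (sub_nonneg.2 (tp hxy hle)) (sub_nonneg.2 (cross hp.1 hle))]
  · linarith [mul_nonneg (sub_nonneg.2 (tp hxy hle)) (sub_nonneg.2 (cross hp.2 hle))]
end

section
/- Let (s_n)_{n≥0} be a probability mass function on ℕ with generating function φ(z) = Σ_{n≥0} s_n z^n. Then φ is a self-reciprocal discrete Van Dantzig generating function, i.e. φ(z)·φ(−z) = φ(0)² for all z ∈ [−1,1], if and only if s_0 > 0 and there exists a real sequence (b_{2n+1})_{n≥0} such that the series Σ_{n≥0} (b_{2n+1}/(2n+1)) z^{2n+1} converges for every z ∈ [−1,1] and φ(z) = φ(0)·exp( Σ_{n≥0} (b_{2n+1}/(2n+1)) z^{2n+1} ) there. -/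
open Set

/-- The power series `f` converges absolutely at radius `r`. -/
def AbsConv (f : PowerSeries ℝ) (r : ℝ) : Prop :=
  Summable fun n => |PowerSeries.coeff n f| * r ^ n

/-- The sum of the power series `f` at the real point `z`. -/
noncomputable def psum (f : PowerSeries ℝ) (z : ℝ) : ℝ :=
  ∑' n, PowerSeries.coeff n f * z ^ n

/-- The weighted `ℓ¹` norm of the coefficients of `f` at radius `r`. -/
noncomputable def wnorm (f : PowerSeries ℝ) (r : ℝ) : ℝ :=
  ∑' n, |PowerSeries.coeff n f| * r ^ n

namespace AbsConv

open PowerSeries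

variable {f g : PowerSeries ℝ} {r z : ℝ}

lemma mono (hf : AbsConv f r) {ρ : ℝ} (h0 : 0 ≤ ρ) (h : ρ ≤ r) : AbsConv f ρ :=
  Summable.of_nonneg_of_le (fun n => by positivity) (fun n => by gcongr) hf

lemma summable_norm (hf : AbsConv f r) (hz : |z| ≤ r) :
    Summable fun n => ‖coeff n f * z ^ n‖ := by
  refine Summable.of_nonneg_of_le (fun n => norm_nonneg _) (fun n => ?_) hf
  rw [norm_mul, norm_pow, Real.norm_eq_abs, Real.norm_eq_abs]
  gcongr

lemma summable (hf : AbsConv f r) (hz : |z| ≤ r) : Summable fun n => coeff n f * z ^ n :=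
  (hf.summable_norm hz).of_norm

lemma abs_psum_le (hf : AbsConv f r) (hz : |z| ≤ r) : |psum f z| ≤ wnorm f r := by
  refine (norm_tsum_le_tsum_norm (hf.summable_norm hz)).trans ?_
  refine (hf.summable_norm hz).tsum_le_tsum (fun n => ?_) hf
  rw [norm_mul, norm_pow, Real.norm_eq_abs, Real.norm_eq_abs]
  gcongr

lemma continuousOn (hf : AbsConv f r) : ContinuousOn (psum f) (Icc (-r) r) := by
  refine continuousOn_tsum (fun n => by fun_prop) hf (fun n x hx => ?_)
  rw [norm_mul, norm_pow, Real.norm_eq_abs, Real.norm_eq_abs]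
  gcongr
  exact abs_le.2 hx

lemma sub (hf : AbsConv f r) (hg : AbsConv g r) (hr : 0 ≤ r) : AbsConv (f - g) r := by
  refine Summable.of_nonneg_of_le (fun n => by positivity) (fun n => ?_) (Summable.add hf hg)
  rw [← add_mul, map_sub]
  gcongr
  exact abs_sub _ _

lemma psum_sub (hf : AbsConv f r) (hg : AbsConv g r) (hz : |z| ≤ r) :
    psum (f - g) z = psum f z - psum g z := by
  rw [psum, psum, psum, ← (hf.summable hz).tsum_sub (hg.summable hz)]
  simp [sub_mul]

lemma abs_coeff_mul_le (hr : 0 ≤ r) (n : ℕ) :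
    |coeff n (f * g)| * r ^ n ≤
      ∑ p ∈ Finset.HasAntidiagonal.antidiagonal n, (|coeff p.1 f| * r ^ p.1) * (|coeff p.2 g| * r ^ p.2) := by
  rw [coeff_mul]
  calc _ ≤ (∑ p ∈ Finset.HasAntidiagonal.antidiagonal n, |coeff p.1 f * coeff p.2 g|) * r ^ n := by
        gcongr
        exact Finset.abs_sum_le_sum_abs _ _
    _ = _ := by
        rw [Finset.sum_mul]
        refine Finset.sum_congr rfl fun p hp => ?_
        rw [← Finset.HasAntidiagonal.mem_antidiagonal.1 hp, abs_mul, pow_add]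
        ring

lemma summable_conv (hf : AbsConv f r) (hg : AbsConv g r) :
    Summable fun n => ∑ p ∈ Finset.HasAntidiagonal.antidiagonal n,
      (|coeff p.1 f| * r ^ p.1) * (|coeff p.2 g| * r ^ p.2) :=
  (summable_norm_sum_mul_antidiagonal_of_summable_norm (f := fun n => |coeff n f| * r ^ n)
    (g := fun n => |coeff n g| * r ^ n) (Summable.abs hf) (Summable.abs hg)).of_norm

lemma mul (hf : AbsConv f r) (hg : AbsConv g r) (hr : 0 ≤ r) : AbsConv (f * g) r :=
  Summable.of_nonneg_of_le (fun n => by positivity) (abs_coeff_mul_le hr)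
    (summable_conv hf hg)

lemma wnorm_mul_le (hf : AbsConv f r) (hg : AbsConv g r) (hr : 0 ≤ r) :
    wnorm (f * g) r ≤ wnorm f r * wnorm g r := by
  rw [wnorm, wnorm, wnorm, tsum_mul_tsum_eq_tsum_sum_antidiagonal_of_summable_norm
    (f := fun n => |coeff n f| * r ^ n) (g := fun n => |coeff n g| * r ^ n)
    (Summable.abs hf) (Summable.abs hg)]
  exact Summable.tsum_le_tsum (abs_coeff_mul_le hr) (mul hf hg hr) (summable_conv hf hg)

lemma psum_mul (hf : AbsConv f r) (hg : AbsConv g r) (hz : |z| ≤ r) :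
    psum (f * g) z = psum f z * psum g z := by
  rw [psum, psum, psum, tsum_mul_tsum_eq_tsum_sum_antidiagonal_of_summable_norm
    (hf.summable_norm hz) (hg.summable_norm hz)]
  refine tsum_congr fun n => ?_
  rw [coeff_mul, Finset.sum_mul]
  refine Finset.sum_congr rfl fun p hp => ?_
  rw [← Finset.HasAntidiagonal.mem_antidiagonal.1 hp, pow_add]
  ring

lemma one : AbsConv 1 r :=
  summable_of_ne_finset_zero (s := {0}) fun n hn => by
    simp [coeff_one, show n ≠ 0 by simpa using hn]

lemma psum_one : psum 1 z = 1 := by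
  rw [psum, tsum_eq_single 0 fun n hn => by simp [coeff_one, hn]]
  simp

lemma psum_zero : psum f 0 = constantCoeff f := by
  rw [psum, tsum_eq_single 0 fun n hn => by simp [hn]]
  simp

lemma wnorm_one : wnorm 1 r = 1 := by
  rw [wnorm, tsum_eq_single 0 fun n hn => by simp [coeff_one, hn]]
  simp

lemma wnorm_nonneg (hr : 0 ≤ r) : 0 ≤ wnorm f r := tsum_nonneg fun n => by positivity

lemma pow (hf : AbsConv f r) (hr : 0 ≤ r) (k : ℕ) : AbsConv (f ^ k) r := by
  induction k with
  | zero => simpa using one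
  | succ k ih => exact pow_succ f k ▸ ih.mul hf hr

lemma wnorm_pow_le (hf : AbsConv f r) (hr : 0 ≤ r) (k : ℕ) :
    wnorm (f ^ k) r ≤ wnorm f r ^ k := by
  induction k with
  | zero => simp [wnorm_one]
  | succ k ih =>
    rw [pow_succ, pow_succ]
    refine ((hf.pow hr k).wnorm_mul_le hf hr).trans ?_
    gcongr
    exact wnorm_nonneg hr

lemma psum_pow (hf : AbsConv f r) (hz : |z| ≤ r) (k : ℕ) : psum (f ^ k) z = psum f z ^ k := by
  have hr : 0 ≤ r := (abs_nonneg z).trans hz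
  induction k with
  | zero => simp [psum_one]
  | succ k ih => rw [pow_succ, pow_succ, (hf.pow hr k).psum_mul hf hz, ih]

/-- A real power series is determined by its sum near the origin. -/
lemma ext (hr : 0 < r) (hf : AbsConv f r) (hg : AbsConv g r)
    (h : ∀ z, |z| < r → psum f z = psum g z) : f = g := by
  have key : ∀ {q : PowerSeries ℝ}, AbsConv q r → (∀ z, |z| < r → psum q z = psum f z) →
      HasFPowerSeriesAt (psum f) (FormalMultilinearSeries.ofScalars ℝ fun n => coeff n q) 0 := by
    intro q hq hqf
    rw [hasFPowerSeriesAt_iff]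
    filter_upwards [Metric.ball_mem_nhds (0 : ℝ) hr] with z hz
    have hz' : |z| < r := by simpa using hz
    rw [zero_add, ← hqf z hz']
    simpa [FormalMultilinearSeries.coeff_ofScalars, mul_comm, psum] using
      (hq.summable hz'.le).hasSum
  have := (key hf fun _ _ => rfl).eq_formalMultilinearSeries
    (key hg fun z hz => (h z hz).symm)
  ext n
  simpa [FormalMultilinearSeries.coeff_ofScalars] using
    congrArg (fun p => FormalMultilinearSeries.coeff p n) this

lemma derivative (hf : AbsConv f r) {ρ : ℝ} (h0 : 0 < ρ) (h : ρ < r) :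
    AbsConv (derivative ℝ f) ρ := by
  have hr : 0 < r := h0.trans h
  have hq : ‖ρ / r‖ < 1 := by
    rw [Real.norm_of_nonneg (by positivity)]
    exact (div_lt_one hr).2 h
  have hb := (summable_pow_mul_geometric_of_norm_lt_one 1 hq).tendsto_atTop_zero.bddAbove_range
  obtain ⟨C, hC⟩ := hb
  have hs := (((summable_nat_add_iff 1).2 hf).mul_left C).mul_left ρ⁻¹
  refine Summable.of_nonneg_of_le (fun n => by positivity) (fun n => ?_) hs
  have hn : ((n + 1 : ℕ) : ℝ) ^ 1 * (ρ / r) ^ (n + 1) ≤ C := hC ⟨n + 1, rfl⟩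
  rw [coeff_derivative, abs_mul, abs_of_nonneg (by positivity : (0 : ℝ) ≤ n + 1)]
  calc |coeff (n + 1) f| * (n + 1) * ρ ^ n
      = ρ⁻¹ * ((((n + 1 : ℕ) : ℝ) ^ 1 * (ρ / r) ^ (n + 1)) *
          (|coeff (n + 1) f| * r ^ (n + 1))) := by
        push_cast
        rw [div_pow]
        field_simp
        ring
    _ ≤ _ := by gcongr

lemma hasDerivAt (hf : AbsConv f r) (hz : |z| < r) :
    HasDerivAt (psum f) (psum (PowerSeries.derivative ℝ f) z) z := by
  obtain ⟨ρ, hzρ, hρ⟩ := exists_between hz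
  have h0 : 0 < ρ := (abs_nonneg z).trans_lt hzρ
  have hd := hf.derivative h0 hρ
  have hz' : z ∈ Ioo (-ρ) ρ := abs_lt.1 hzρ
  have hu : Summable fun n : ℕ => |coeff n f| * n * ρ ^ (n - 1) := by
    refine (summable_nat_add_iff 1).1 (hd.congr fun n => ?_)
    rw [coeff_derivative, abs_mul, abs_of_nonneg (by positivity : (0 : ℝ) ≤ n + 1)]
    simp
  have hbd : ∀ (n : ℕ), ∀ y ∈ Ioo (-ρ) ρ,
      ‖coeff n f * (n * y ^ (n - 1))‖ ≤ |coeff n f| * n * ρ ^ (n - 1) := by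
    intro n y hy
    rw [norm_mul, norm_mul, norm_pow, Real.norm_eq_abs, Real.norm_eq_abs, Real.norm_eq_abs,
      Nat.abs_cast, ← mul_assoc]
    gcongr
    exact (abs_lt.2 hy).le
  have key := hasDerivAt_tsum_of_isPreconnected hu isOpen_Ioo isPreconnected_Ioo
    (fun n y _ => (hasDerivAt_pow n y).const_mul (coeff n f)) hbd hz'
    (hf.summable hz.le) hz'
  have hs : Summable fun n : ℕ => coeff n f * (n * z ^ (n - 1)) :=
    Summable.of_norm (Summable.of_nonneg_of_le (fun n => norm_nonneg _)
      (fun n => hbd n z hz') hu)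
  have heq : psum (PowerSeries.derivative ℝ f) z = ∑' n : ℕ, coeff n f * (n * z ^ (n - 1)) := by
    rw [hs.tsum_eq_zero_add, psum]
    simp [coeff_derivative, mul_assoc]
  exact heq ▸ key

/-- The logarithm of `1 - f` has absolutely convergent power series if the coefficient
norm of `f` is less than one. -/
lemma exists_log (hf : AbsConv f r) (hr₀ : 0 < r) (h : wnorm f r < 1) :
    ∃ l, AbsConv l r ∧ ∀ z, |z| ≤ r → psum l z = -Real.log (1 - psum f z) := by
  have hr : 0 ≤ r := hr₀.le
  have hk : ∀ k : ℕ, Summable fun n => |coeff n (f ^ (k + 1)) / (k + 1)| * r ^ n := fun k => by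
    refine (Summable.div_const (hf.pow hr (k + 1)) ((k : ℝ) + 1)).congr fun n => ?_
    rw [abs_div, abs_of_nonneg (by positivity : (0 : ℝ) ≤ k + 1)]
    ring
  have hprod : Summable fun p : ℕ × ℕ =>
      |coeff p.2 (f ^ (p.1 + 1)) / (p.1 + 1)| * r ^ p.2 := by
    refine (summable_prod_of_nonneg fun p => by positivity).2 ⟨hk, ?_⟩
    refine Summable.of_nonneg_of_le (fun k => tsum_nonneg fun n => by positivity) (fun k => ?_)
      (summable_geometric_of_lt_one (wnorm_nonneg hr) h |>.mul_right (wnorm f r))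
    rw [← pow_succ]
    refine le_trans ?_ (hf.wnorm_pow_le hr (k + 1))
    refine (hk k).tsum_le_tsum (fun n => ?_) (hf.pow hr (k + 1))
    refine mul_le_mul_of_nonneg_right ?_ (by positivity)
    rw [abs_div, abs_of_nonneg (by positivity : (0 : ℝ) ≤ k + 1)]
    exact div_le_self (abs_nonneg _) (by simp)
  have hswap := hprod.prod_symm
  refine ⟨PowerSeries.mk fun n => ∑' k : ℕ, coeff n (f ^ (k + 1)) / (k + 1), ?_, ?_⟩
  · refine Summable.of_nonneg_of_le (fun n => by positivity) (fun n => ?_) hswap.prod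
    have hn : Summable fun k : ℕ => |coeff n (f ^ (k + 1)) / (k + 1)| :=
      ((hswap.prod_factor n).mul_right (r ^ n)⁻¹).congr fun k =>
        mul_inv_cancel_right₀ (by positivity) _
    have hle : |∑' k : ℕ, coeff n (f ^ (k + 1)) / (k + 1)| ≤
        ∑' k : ℕ, |coeff n (f ^ (k + 1)) / (k + 1)| :=
      norm_tsum_le_tsum_norm (f := fun k : ℕ => coeff n (f ^ (k + 1)) / ((k : ℝ) + 1)) hn
    rw [coeff_mk]
    refine (mul_le_mul_of_nonneg_right hle (by positivity)).trans ?_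
    exact tsum_mul_right.symm.le
  · intro z hz
    have hlt : |psum f z| < 1 := (hf.abs_psum_le hz).trans_lt h
    have hsum : Summable (Function.uncurry fun k n : ℕ =>
        coeff n (f ^ (k + 1)) / (k + 1) * z ^ n) := by
      refine Summable.of_norm (Summable.of_nonneg_of_le (fun p => norm_nonneg _)
        (fun p => ?_) hprod)
      simp only [Function.uncurry, norm_mul, norm_pow, Real.norm_eq_abs]
      gcongr
    rw [← (Real.hasSum_pow_div_log_of_abs_lt_one hlt).tsum_eq, psum]
    simp only [coeff_mk, ← tsum_mul_right]
    rw [hsum.tsum_comm]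
    refine tsum_congr fun k => ?_
    rw [← hf.psum_pow hz, psum, ← tsum_div_const]
    exact tsum_congr fun n => by ring

end AbsConv

namespace AbsConv

open PowerSeries

variable {f : PowerSeries ℝ} {r z c : ℝ}

lemma rescale (hf : AbsConv f r) (hr : 0 ≤ r) (hc : |c| ≤ 1) : AbsConv (rescale c f) r := by
  refine Summable.of_nonneg_of_le (fun n => by positivity) (fun n => ?_) hf
  rw [coeff_rescale, abs_mul, abs_pow]
  gcongr
  exact mul_le_of_le_one_left (abs_nonneg _) (pow_le_one₀ (abs_nonneg c) hc)

lemma psum_rescale : psum (PowerSeries.rescale c f) z = psum f (c * z) := by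
  refine tsum_congr fun n => ?_
  rw [coeff_rescale]
  ring

/-- An absolutely convergent power series is close in coefficient norm to its dilations. -/
lemma exists_wnorm_sub_rescale_lt (hf : AbsConv f 1) {ε : ℝ} (hε : 0 < ε) :
    ∃ r, 0 < r ∧ r < 1 ∧ wnorm (f - PowerSeries.rescale r f) 1 < ε := by
  have ha : AbsConv (PowerSeries.mk fun n => |coeff n f|) 1 := by
    simpa [AbsConv] using hf
  have hcont := (ha.continuousOn 1 (by simp)).mono
    (show Ioo (0 : ℝ) 1 ⊆ Icc (-1) 1 from fun x hx => ⟨by linarith [hx.1], hx.2.le⟩)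
  have : (nhdsWithin (1 : ℝ) (Ioo 0 1)).NeBot := by
    rw [← mem_closure_iff_nhdsWithin_neBot, closure_Ioo (by norm_num)]
    simp
  obtain ⟨r, hr, hr'⟩ := ((hcont.eventually (lt_mem_nhds (sub_lt_self _ hε))).and
    self_mem_nhdsWithin).exists
  refine ⟨r, hr'.1, hr'.2, ?_⟩
  have hr1 : |r| ≤ 1 := abs_le.2 ⟨by linarith [hr'.1], hr'.2.le⟩
  have heq : wnorm (f - PowerSeries.rescale r f) 1 =
      psum (PowerSeries.mk fun n => |coeff n f|) 1 -
        psum (PowerSeries.mk fun n => |coeff n f|) r := by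
    rw [psum, psum, ← (ha.summable (by simp)).tsum_sub (ha.summable hr1)]
    refine tsum_congr fun n => ?_
    have h1 : r ^ n ≤ 1 := pow_le_one₀ hr'.1.le hr'.2.le
    rw [map_sub, coeff_rescale, coeff_mk, one_pow, mul_one, mul_one,
      show coeff n f - r ^ n * coeff n f = coeff n f * (1 - r ^ n) by ring, abs_mul,
      abs_of_nonneg (sub_nonneg.2 h1)]
    ring
  linarith

/-- A power series converges absolutely wherever its derivative does. -/
lemma of_derivative (h : AbsConv (PowerSeries.derivative ℝ f) r) (hr : 0 ≤ r) :
    AbsConv f r := by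
  refine (summable_nat_add_iff 1).1 (Summable.of_nonneg_of_le (fun n => by positivity)
    (fun n => ?_) (Summable.mul_right r h))
  rw [coeff_derivative, abs_mul, abs_of_nonneg (by positivity : (0 : ℝ) ≤ n + 1), pow_succ,
    ← mul_assoc]
  gcongr
  exact le_mul_of_one_le_right (abs_nonneg _) (by simp)

/-- If `f(z) f(-z) = 1`, then on `(-1, 1)` the function `f` is the exponential of the power series
whose derivative is the logarithmic derivative of `f`. -/
lemma exists_exp_of_mul_eq_one (hf : AbsConv f 1) (h0 : constantCoeff f = 1)
    (h : f * PowerSeries.rescale (-1) f = 1) :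
    ∃ g : PowerSeries ℝ, constantCoeff g = 0 ∧ (∀ ρ, 0 < ρ → ρ < 1 → AbsConv g ρ) ∧
      ∀ z, |z| < 1 → psum f z = Real.exp (psum g z) := by
  have hneg : AbsConv (PowerSeries.rescale (-1) f) 1 := hf.rescale zero_le_one (by simp)
  set d := PowerSeries.derivative ℝ f * PowerSeries.rescale (-1) f with hd
  set g : PowerSeries ℝ := PowerSeries.mk fun n => coeff (n - 1) d / n with hg
  have hgd : PowerSeries.derivative ℝ g = d := by
    ext n
    rw [coeff_derivative, hg, coeff_mk]
    push_cast
    exact div_mul_cancel₀ _ (by positivity)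
  have hg0 : constantCoeff g = 0 := by
    rw [← coeff_zero_eq_constantCoeff_apply, hg, coeff_mk]
    simp
  have hgρ : ∀ ρ, 0 < ρ → ρ < 1 → AbsConv g ρ := fun ρ h0 h1 =>
    of_derivative (hgd ▸ (hf.derivative h0 h1).mul (hneg.mono h0.le h1.le) h0.le) h0.le
  refine ⟨g, hg0, hgρ, ?_⟩
  have hder : ∀ z ∈ Ioo (-1 : ℝ) 1,
      HasDerivAt (fun z => psum f z * Real.exp (-psum g z)) 0 z := by
    intro z hz
    have hz := abs_lt.2 hz
    obtain ⟨ρ, hzρ, hρ⟩ := exists_between hz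
    have hρ0 : 0 < ρ := (abs_nonneg z).trans_lt hzρ
    have hmul : psum f z * psum (PowerSeries.rescale (-1) f) z = 1 := by
      rw [← hf.psum_mul hneg hz.le, h, psum_one]
    have hdz : psum (PowerSeries.derivative ℝ g) z =
        psum (PowerSeries.derivative ℝ f) z * psum (PowerSeries.rescale (-1) f) z := by
      rw [hgd, hd, (hf.derivative hρ0 hρ).psum_mul (hneg.mono hρ0.le hρ.le) hzρ.le]
    have hD := (hf.hasDerivAt hz).mul ((hgρ ρ hρ0 hρ).hasDerivAt hzρ).neg.exp
    refine hD.congr_deriv ?_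
    simp only [Pi.neg_apply]
    rw [hdz]
    linear_combination -psum (PowerSeries.derivative ℝ f) z * Real.exp (-psum g z) * hmul
  intro z hz
  have hconst := isOpen_Ioo.is_const_of_deriv_eq_zero isPreconnected_Ioo
    (fun x hx => (hder x hx).differentiableAt.differentiableWithinAt)
    (fun x hx => (hder x hx).deriv) (abs_lt.1 hz) (show (0 : ℝ) ∈ Ioo (-1 : ℝ) 1 by simp)
  simp only [psum_zero, h0, hg0, neg_zero, Real.exp_zero, mul_one, Real.exp_neg] at hconst
  exact (mul_inv_eq_one₀ (Real.exp_ne_zero _)).1 hconst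

/-- If `f(z) f(-z) = 1`, then `f` is the exponential of an odd power series with absolutely
summable coefficients. -/
lemma exists_odd_exp_of_mul_eq_one (hf : AbsConv f 1) (h0 : constantCoeff f = 1)
    (h : f * PowerSeries.rescale (-1) f = 1) :
    ∃ g : PowerSeries ℝ, AbsConv g 1 ∧ (∀ n, Even n → coeff n g = 0) ∧
      ∀ z ∈ Icc (-1 : ℝ) 1, psum f z = Real.exp (psum g z) := by
  obtain ⟨g, hg0, hgρ, hexp⟩ := hf.exists_exp_of_mul_eq_one h0 h
  have hneg : AbsConv (PowerSeries.rescale (-1) f) 1 := hf.rescale zero_le_one (by simp)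
  have hhalf := hgρ (1 / 2) (by norm_num) (by norm_num)
  have hodd : ∀ z, |z| < 1 → psum g (-z) = -psum g z := by
    intro z hz
    have h1 : psum f z * psum f (-z) = 1 := by
      rw [← neg_one_mul z, ← psum_rescale, ← hf.psum_mul hneg hz.le, h, psum_one]
    rw [hexp z hz, hexp (-z) (by rwa [abs_neg]), ← Real.exp_add, Real.exp_eq_one_iff] at h1
    linarith
  have heven : ∀ n, Even n → coeff n g = 0 := by
    have hzero : AbsConv (0 : PowerSeries ℝ) (1 / 2) := by simp [AbsConv, summable_zero]
    have hrs : AbsConv (PowerSeries.rescale (-1) g) (1 / 2) :=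
      hhalf.rescale (by norm_num) (by simp)
    have : PowerSeries.rescale (-1) g = 0 - g := by
      refine AbsConv.ext (r := 1 / 2) (by norm_num) hrs (hzero.sub hhalf (by norm_num)) ?_
      intro z hz
      rw [psum_rescale, hzero.psum_sub hhalf hz.le, neg_one_mul, hodd z (by linarith)]
      simp [psum]
    intro n hn
    have := congrArg (coeff n) this
    rw [coeff_rescale, hn.neg_one_pow] at this
    simp only [one_mul, zero_sub, map_neg] at this
    linarith
  have hg : AbsConv g 1 := by
    obtain ⟨r, hr0, hr1, hr⟩ := hf.exists_wnorm_sub_rescale_lt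
      (ε := (wnorm (PowerSeries.rescale (-1) f) 1 + 1)⁻¹)
      (inv_pos.2 (add_pos_of_nonneg_of_pos (wnorm_nonneg zero_le_one) one_pos))
    have hr' : |r| ≤ 1 := abs_le.2 ⟨by linarith, hr1.le⟩
    have hfr : AbsConv (PowerSeries.rescale r f) 1 := hf.rescale zero_le_one hr'
    have hsub := hf.sub hfr zero_le_one
    have hu := hsub.mul hneg zero_le_one
    have hlt : wnorm ((f - PowerSeries.rescale r f) * PowerSeries.rescale (-1) f) 1 < 1 := by
      refine (hsub.wnorm_mul_le hneg zero_le_one).trans_lt ?_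
      have hN : 0 ≤ wnorm (PowerSeries.rescale (-1) f) 1 := wnorm_nonneg zero_le_one
      have hpos : 0 < wnorm (PowerSeries.rescale (-1) f) 1 + 1 := by linarith
      rw [← one_div, lt_div_iff₀ hpos] at hr
      have hN' : 0 ≤ wnorm (f - PowerSeries.rescale r f) 1 := wnorm_nonneg zero_le_one
      nlinarith
    obtain ⟨l, hl, hlog⟩ := hu.exists_log one_pos hlt
    have hlg : l = g - PowerSeries.rescale r g := by
      have hgr : AbsConv (PowerSeries.rescale r g) (1 / 2) := hhalf.rescale (by norm_num) hr'
      refine AbsConv.ext (r := 1 / 2) (by norm_num) (hl.mono (by norm_num) (by norm_num))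
        (hhalf.sub hgr (by norm_num)) fun z hz => ?_
      have hz1 : |z| < 1 := by linarith
      have hrz : |r * z| < 1 := by
        rw [abs_mul]
        exact (mul_le_of_le_one_left (abs_nonneg z) hr').trans_lt hz1
      rw [hlog z hz1.le, hhalf.psum_sub hgr hz.le, hsub.psum_mul hneg hz1.le,
        hf.psum_sub hfr hz1.le, psum_rescale, psum_rescale, psum_rescale, neg_one_mul,
        hexp z hz1, hexp _ hrz, hexp (-z) (by rwa [abs_neg]), hodd z hz1, sub_mul,
        ← Real.exp_add, ← Real.exp_add, add_neg_cancel, Real.exp_zero, sub_sub_cancel,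
        Real.log_exp]
      ring
    refine Summable.of_nonneg_of_le (fun n => by positivity) (fun n => ?_)
      (Summable.mul_left (1 - r)⁻¹ hl)
    rw [one_pow, mul_one, mul_one, inv_mul_eq_div, le_div_iff₀ (by linarith)]
    rcases n with _ | n
    · simp [hg0]
    · have h1 : r ^ (n + 1) ≤ r := pow_le_of_le_one hr0.le hr1.le (by simp)
      rw [hlg, map_sub, coeff_rescale, ← one_sub_mul, abs_mul, mul_comm,
        abs_of_nonneg (a := 1 - r ^ (n + 1)) (by linarith)]
      gcongr
  refine ⟨g, hg, heven, ?_⟩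
  refine Set.EqOn.of_subset_closure (s := Ioo (-1 : ℝ) 1) (fun z hz => hexp z (abs_lt.2 hz))
    hf.continuousOn (Real.continuous_exp.comp_continuousOn hg.continuousOn) Ioo_subset_Icc_self ?_
  rw [closure_Ioo (by norm_num)]

end AbsConv

/-- A probability generating function `φ(z) = Σ s_n zⁿ` on `ℕ` is a
self-reciprocal discrete Van Dantzig generating function, i.e. `φ(z)φ(-z) = φ(0)²`
on `[-1,1]`, if and only if `s_0 > 0` and
`φ(z) = φ(0) exp(Σ_{n≥0} (b_{2n+1}/(2n+1)) z^{2n+1})` on `[-1,1]` for some real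
sequence `(b_{2n+1})`. -/
theorem selfReciprocal_vanDantzig_iff
    (s : ℕ → ℝ) (hs : ∀ n, 0 ≤ s n) (hsum : HasSum s 1) :
    (∀ z ∈ Icc (-1 : ℝ) 1,
        (∑' n : ℕ, s n * z ^ n) * (∑' n : ℕ, s n * (-z) ^ n) =
          (∑' n : ℕ, s n * (0 : ℝ) ^ n) ^ 2) ↔
      0 < s 0 ∧
        ∃ b : ℕ → ℝ, ∀ z ∈ Icc (-1 : ℝ) 1,
          (Summable fun n : ℕ => b n / (2 * n + 1) * z ^ (2 * n + 1)) ∧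
            (∑' n : ℕ, s n * z ^ n) =
              (∑' n : ℕ, s n * (0 : ℝ) ^ n) *
                Real.exp (∑' n : ℕ, b n / (2 * n + 1) * z ^ (2 * n + 1)) := by
  have hzero : (∑' n : ℕ, s n * (0 : ℝ) ^ n) = s 0 := by
    rw [tsum_eq_single 0 fun n hn => by simp [hn]]
    simp
  rw [hzero]
  constructor
  · intro h
    set F : PowerSeries ℝ := PowerSeries.mk s with hF
    have hFz : ∀ z, psum F z = ∑' n : ℕ, s n * z ^ n := fun z => by simp [psum, hF]
    have hFc : AbsConv F 1 := by
      simpa [AbsConv, hF, abs_of_nonneg (hs _)] using hsum.summable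
    have hFneg : AbsConv (PowerSeries.rescale (-1) F) 1 := hFc.rescale zero_le_one (by simp)
    have hC : AbsConv (PowerSeries.C (s 0 ^ 2)) 1 :=
      summable_of_ne_finset_zero (s := {0}) fun n hn => by
        simp [PowerSeries.coeff_C, show n ≠ 0 by simpa using hn, -map_pow]
    have hprod : F * PowerSeries.rescale (-1) F = PowerSeries.C (s 0 ^ 2) := by
      refine AbsConv.ext one_pos (hFc.mul hFneg zero_le_one) hC fun z hz => ?_
      rw [hFc.psum_mul hFneg hz.le, AbsConv.psum_rescale, hFz, hFz, neg_one_mul,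
        h z (abs_le.1 hz.le), psum, tsum_eq_single 0 fun n hn => by
          simp [PowerSeries.coeff_C, hn, -map_pow]]
      simp
    have hpos : 0 < s 0 := by
      refine (hs 0).lt_of_ne' fun h0 => ?_
      have hs0 : s = 0 := by
        ext n
        rw [h0, zero_pow two_ne_zero, map_zero, mul_eq_zero] at hprod
        rcases hprod with hp | hp
        · simpa [hF] using congrArg (PowerSeries.coeff n) hp
        · simpa [hF] using congrArg (PowerSeries.coeff n) hp
      simpa [hs0] using hsum.tsum_eq
    refine ⟨hpos, ?_⟩
    set G : PowerSeries ℝ := PowerSeries.C (s 0)⁻¹ * F with hG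
    have hGz : ∀ z, psum G z = (s 0)⁻¹ * psum F z := fun z => by
      simp [psum, hG, mul_assoc, tsum_mul_left]
    have hGc : AbsConv G 1 := by
      refine (Summable.mul_left |(s 0)⁻¹| hFc).congr fun n => ?_
      rw [hG, PowerSeries.coeff_C_mul, abs_mul, mul_assoc]
    have hG0 : PowerSeries.constantCoeff G = 1 := by
      rw [hG, map_mul, PowerSeries.constantCoeff_C, ← PowerSeries.coeff_zero_eq_constantCoeff_apply,
        hF, PowerSeries.coeff_mk, inv_mul_cancel₀ hpos.ne']
    have hG1 : G * PowerSeries.rescale (-1) G = 1 := by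
      have hrC : PowerSeries.rescale (-1 : ℝ) (PowerSeries.C (s 0)⁻¹) = PowerSeries.C (s 0)⁻¹ := by
        ext n
        rcases n with _ | n <;> simp [PowerSeries.coeff_C]
      rw [hG, map_mul, hrC, mul_mul_mul_comm, hprod, ← map_mul, ← map_mul]
      rw [show (s 0)⁻¹ * (s 0)⁻¹ * s 0 ^ 2 = 1 by field_simp, map_one]
    obtain ⟨g, hg, heven, hexp⟩ := hGc.exists_odd_exp_of_mul_eq_one hG0 hG1
    refine ⟨fun n => (2 * n + 1) * PowerSeries.coeff (2 * n + 1) g, fun z hz => ?_⟩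
    have hterm : (fun n : ℕ => (2 * (n : ℝ) + 1) * PowerSeries.coeff (2 * n + 1) g / (2 * n + 1) *
        z ^ (2 * n + 1)) =
        (fun n : ℕ => PowerSeries.coeff n g * z ^ n) ∘ fun n : ℕ => 2 * n + 1 := by
      ext n
      rw [mul_div_cancel_left₀ _ (by positivity)]
      rfl
    have hinj : Function.Injective fun n : ℕ => 2 * n + 1 := fun m n h => by
      simpa using h
    have hHS : HasSum ((fun n : ℕ => PowerSeries.coeff n g * z ^ n) ∘ fun n : ℕ => 2 * n + 1)
        (psum g z) := by
      refine (hinj.hasSum_iff fun n hn => ?_).2 (hg.summable (abs_le.2 hz)).hasSum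
      rw [heven n, zero_mul]
      by_contra hne
      obtain ⟨m, hm⟩ := Nat.not_even_iff_odd.1 hne
      exact hn ⟨m, hm.symm⟩
    rw [hterm, hHS.tsum_eq, ← hexp z hz, hGz, hFz, mul_inv_cancel_left₀ hpos.ne']
    exact ⟨hHS.summable, rfl⟩
  · rintro ⟨-, b, hb⟩ z hz
    have hz' : -z ∈ Icc (-1 : ℝ) 1 := ⟨by linarith [hz.2], by linarith [hz.1]⟩
    have hodd : (∑' n : ℕ, b n / (2 * n + 1) * (-z) ^ (2 * n + 1)) =
        -∑' n : ℕ, b n / (2 * n + 1) * z ^ (2 * n + 1) := by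
      rw [← tsum_neg]
      refine tsum_congr fun n => ?_
      rw [Odd.neg_pow ⟨n, rfl⟩, mul_neg]
    rw [(hb z hz).2, (hb (-z) hz').2, hodd, mul_mul_mul_comm, ← Real.exp_add,
      add_neg_cancel, Real.exp_zero]
    ring
end

section
/- Let (s_n) and (t_n) be probability mass functions on ℕ with generating functions f and g forming a discrete Van Dantzig pair, i.e. f(z)·g(−z) = f(0)·g(0) for all z ∈ [−1,1], and suppose f ≠ g. If (s_n) is infinitely divisible, then (t_n) is not infinitely divisible. -/
open Set

/-- Convolution of two mass functions on `ℕ`. -/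
noncomputable def seqConv (u v : ℕ → ℝ) : ℕ → ℝ :=
  fun n => ∑ k ∈ Finset.range (n + 1), u k * v (n - k)

/-- `k`-fold convolution power of a mass function on `ℕ`. -/
noncomputable def seqConvPow (u : ℕ → ℝ) : ℕ → ℕ → ℝ
  | 0 => fun n => if n = 0 then 1 else 0
  | k + 1 => seqConv u (seqConvPow u k)

/-- A probability mass function on `ℕ` is infinitely divisible if for every `k ≥ 1`
it is the `k`-fold convolution of some probability mass function on `ℕ`. -/
def IsInfDivisiblePMF (s : ℕ → ℝ) : Prop :=
  ∀ k : ℕ, 1 ≤ k → ∃ u : ℕ → ℝ, (∀ n, 0 ≤ u n) ∧ HasSum u 1 ∧ seqConvPow u k = s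

section

open PowerSeries

lemma mk_seqConvPow (u : ℕ → ℝ) (k : ℕ) : mk (seqConvPow u k) = mk u ^ k := by
  induction k with
  | zero =>
    ext n
    simp [seqConvPow, coeff_one]
  | succ k ih =>
    rw [pow_succ', ← ih]
    ext n
    rw [coeff_mul, Finset.Nat.sum_antidiagonal_eq_sum_range_succ_mk]
    simp [seqConvPow, seqConv]

lemma IsInfDivisiblePMF.apply_zero_ne_zero {s : ℕ → ℝ} (hID : IsInfDivisiblePMF s)
    (hsum : HasSum s 1) : s 0 ≠ 0 := by
  intro h0
  have hs : s = 0 := by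
    funext n
    obtain ⟨u, -, -, hus⟩ := hID (n + 1) (by omega)
    have hpow : mk u ^ (n + 1) = mk s := by rw [← mk_seqConvPow, hus]
    have hu0 : constantCoeff (mk u) = 0 := by
      have := congrArg constantCoeff hpow
      rw [map_pow] at this
      refine eq_zero_of_pow_eq_zero (n := n + 1) (this.trans ?_)
      simpa [← coeff_zero_eq_constantCoeff_apply] using h0
    have hdvd : (X : ℝ⟦X⟧) ^ (n + 1) ∣ mk s := hpow ▸ pow_dvd_pow_of_dvd (X_dvd_iff.2 hu0) _
    simpa using X_pow_dvd_iff.1 hdvd n (by omega)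
  subst hs
  exact zero_ne_one (hasSum_zero.unique hsum)

/-- The logarithmic derivative of the generating function of an infinitely divisible mass function
has nonnegative coefficients. -/
lemma IsInfDivisiblePMF.coeff_nonneg_of_derivative_eq {s : ℕ → ℝ} (hID : IsInfDivisiblePMF s)
    (hs0 : 0 < s 0) {R : ℝ⟦X⟧} (hR : d⁄dX ℝ (mk s) = R * mk s) (n : ℕ) : 0 ≤ coeff n R := by
  by_contra! hneg
  set K : ℝ := ∑ i ∈ Finset.range (n + 1), |coeff i R| with hK
  have hK0 : 0 ≤ K := Finset.sum_nonneg fun _ _ => abs_nonneg _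
  obtain ⟨k, hk⟩ := exists_nat_gt (K * K / (-coeff n R * s 0))
  have hden : 0 < -coeff n R * s 0 := mul_pos (by linarith) hs0
  have hkpos : (0 : ℝ) < k := lt_of_le_of_lt (by positivity) hk
  have hk1 : 1 ≤ k := by exact_mod_cast hkpos
  obtain ⟨u, hu, husum, hus⟩ := hID k hk1
  have hu1 : ∀ j, u j ≤ 1 := fun j => le_hasSum husum j fun i _ => hu i
  have hpow : mk u ^ k = mk s := by rw [← mk_seqConvPow, hus]
  have hs0u : s 0 = u 0 ^ k := by
    have := congrArg constantCoeff hpow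
    simpa using this.symm
  have hsu : s 0 ≤ u 0 := hs0u ▸ pow_le_of_le_one (hu 0) (hu1 0) (by omega)
  have hU0 : (mk u : ℝ⟦X⟧) ≠ 0 := by
    intro h
    have := congrArg (coeff 0) h
    simp at this
    linarith
  have hkU : (k : ℝ⟦X⟧) * d⁄dX ℝ (mk u) = R * mk u := by
    rw [← hpow, derivative_pow] at hR
    apply mul_left_cancel₀ (pow_ne_zero (k - 1) hU0)
    have hsplit : (mk u : ℝ⟦X⟧) ^ k = mk u ^ (k - 1) * mk u := by
      rw [← pow_succ, Nat.sub_add_cancel hk1]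
    linear_combination hR + R * hsplit
  have hcoeff : ∀ m, (k : ℝ) * (u (m + 1) * (m + 1)) =
      ∑ i ∈ Finset.range (m + 1), coeff i R * u (m - i) := by
    intro m
    have := congrArg (coeff m) hkU
    rw [← map_natCast (C (R := ℝ)), coeff_C_mul, coeff_derivative, coeff_mul,
      Finset.Nat.sum_antidiagonal_eq_sum_range_succ_mk] at this
    simpa using this
  have hsmall : ∀ m < n, (k : ℝ) * u (m + 1) ≤ K := by
    intro m hm
    calc (k : ℝ) * u (m + 1) ≤ k * (u (m + 1) * (m + 1)) := by
          gcongr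
          exact le_mul_of_one_le_right (hu _) (by linarith [Nat.cast_nonneg (α := ℝ) m])
      _ = ∑ i ∈ Finset.range (m + 1), coeff i R * u (m - i) := hcoeff m
      _ ≤ ∑ i ∈ Finset.range (m + 1), |coeff i R| := by
          refine Finset.sum_le_sum fun i _ => ?_
          exact (mul_le_mul_of_nonneg_right (le_abs_self _) (hu _)).trans
            (mul_le_of_le_one_right (abs_nonneg _) (hu1 _))
      _ ≤ K := Finset.sum_le_sum_of_subset_of_nonneg
          (Finset.range_subset_range.2 (by omega)) fun _ _ _ => abs_nonneg _
  have hlow : (k : ℝ) * ∑ i ∈ Finset.range n, coeff i R * u (n - i) ≤ K * K := by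
    rw [Finset.mul_sum]
    calc ∑ i ∈ Finset.range n, (k : ℝ) * (coeff i R * u (n - i))
        ≤ ∑ i ∈ Finset.range n, |coeff i R| * K := by
          refine Finset.sum_le_sum fun i hi => ?_
          have hi' := Finset.mem_range.1 hi
          have hb := hsmall (n - i - 1) (by omega)
          rw [show n - i - 1 + 1 = n - i by omega] at hb
          calc (k : ℝ) * (coeff i R * u (n - i)) = coeff i R * (k * u (n - i)) := by ring
            _ ≤ |coeff i R| * (k * u (n - i)) :=
              mul_le_mul_of_nonneg_right (le_abs_self _) (mul_nonneg hkpos.le (hu _))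
            _ ≤ |coeff i R| * K := mul_le_mul_of_nonneg_left hb (abs_nonneg _)
      _ = (∑ i ∈ Finset.range n, |coeff i R|) * K := by rw [Finset.sum_mul]
      _ ≤ K * K := by
          refine mul_le_mul_of_nonneg_right ?_ hK0
          rw [hK, Finset.sum_range_succ]
          exact le_add_of_nonneg_right (abs_nonneg _)
  have htop : 0 ≤ ∑ i ∈ Finset.range n, coeff i R * u (n - i) + coeff n R * u 0 := by
    have h := hcoeff n
    rw [Finset.sum_range_succ, Nat.sub_self] at h
    rw [← h]
    have := hu (n + 1)
    positivity
  have hupper : (k : ℝ) * (-coeff n R * s 0) ≤ K * K := by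
    have h1 : (k : ℝ) * (-coeff n R * s 0) ≤ k * (-coeff n R * u 0) := by
      gcongr
      linarith
    have h2 := mul_nonneg hkpos.le htop
    linarith
  rw [div_lt_iff₀ hden] at hk
  linarith

/-- A real power series whose sum is constant near `0` has vanishing higher coefficients. -/
lemma PowerSeries.eq_C_of_eventually_hasSum {F : PowerSeries ℝ} {c : ℝ}
    (h : ∀ᶠ z in nhds (0 : ℝ), HasSum (fun n => coeff n F * z ^ n) c) : F = C c := by
  have hF : HasFPowerSeriesAt (0 : ℝ → ℝ)
      (FormalMultilinearSeries.ofScalars ℝ fun n => coeff n (F - C c)) 0 := by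
    rw [hasFPowerSeriesAt_iff]
    filter_upwards [h] with z hz
    have hc : HasSum (fun n => coeff n (C c) * z ^ n) c := by
      convert hasSum_single (f := fun n => coeff n (C c) * z ^ n) 0 ?_ using 1
      · simp
      · intro n hn
        simp [coeff_C, hn]
    have := hz.sub hc
    simp only [FormalMultilinearSeries.coeff_ofScalars, smul_eq_mul, Pi.zero_apply]
    rw [sub_self] at this
    refine this.congr_fun ?_
    intro n
    rw [map_sub]
    ring
  rw [← sub_eq_zero]
  ext n
  rw [← FormalMultilinearSeries.coeff_ofScalars (p := fun n => coeff n (F - C c)), hF.eq_zero]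
  rfl

lemma PowerSeries.derivative_rescale (a : ℝ) (F : ℝ⟦X⟧) :
    d⁄dX ℝ (rescale a F) = C a * rescale a (d⁄dX ℝ F) := by
  ext n
  simp only [coeff_derivative, coeff_rescale, coeff_C_mul]
  ring

lemma summable_norm_mul_pow {s : ℕ → ℝ} (hs : Summable s) (hs0 : ∀ n, 0 ≤ s n) {z : ℝ}
    (hz : |z| ≤ 1) : Summable fun n => ‖s n * z ^ n‖ := by
  refine hs.of_nonneg_of_le (fun _ => norm_nonneg _) fun n => ?_
  rw [norm_mul, norm_pow, Real.norm_of_nonneg (hs0 n)]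
  exact mul_le_of_le_one_right (hs0 n) (pow_le_one₀ (norm_nonneg _) hz)

lemma mk_mul_rescale_neg_one_eq_C {s t : ℕ → ℝ} (hs : ∀ n, 0 ≤ s n) (hssum : Summable s)
    (ht : ∀ n, 0 ≤ t n) (htsum : Summable t) {c : ℝ}
    (h : ∀ z ∈ Icc (-1 : ℝ) 1, (∑' n : ℕ, s n * z ^ n) * (∑' n : ℕ, t n * (-z) ^ n) = c) :
    mk s * rescale (-1) (mk t) = C c := by
  apply PowerSeries.eq_C_of_eventually_hasSum
  filter_upwards [Icc_mem_nhds (show (-1 : ℝ) < 0 by norm_num) one_pos] with z hz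
  have hz1 : |z| ≤ 1 := abs_le.2 hz
  have hsz := summable_norm_mul_pow hssum hs hz1
  have htz := summable_norm_mul_pow htsum ht (z := -z) (by rwa [abs_neg])
  have hsummable := (summable_norm_sum_mul_antidiagonal_of_summable_norm hsz htz).of_norm
  have hprod := tsum_mul_tsum_eq_tsum_sum_antidiagonal_of_summable_norm hsz htz
  rw [h z hz] at hprod
  have hsum := hsummable.hasSum
  rw [← hprod] at hsum
  refine hsum.congr_fun fun n => ?_
  rw [coeff_mul, Finset.sum_mul]
  refine Finset.sum_congr rfl fun p hp => ?_
  rw [← Finset.HasAntidiagonal.mem_antidiagonal.1 hp]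
  simp only [coeff_mk, coeff_rescale]
  rw [neg_pow z]
  ring

/-- Power series over a field with the same logarithmic derivative are proportional. -/
lemma PowerSeries.eq_C_mul_of_derivative_eq {F G R : ℝ⟦X⟧} (hG : constantCoeff G ≠ 0)
    (hF' : d⁄dX ℝ F = R * F) (hG' : d⁄dX ℝ G = R * G) :
    F = C (constantCoeff F / constantCoeff G) * G := by
  have hGG : G⁻¹ * G = 1 := PowerSeries.inv_mul_cancel G hG
  have hquot : F * G⁻¹ = C (constantCoeff F / constantCoeff G) := by
    apply derivative.ext
    · simp only [Derivation.leibniz, smul_eq_mul, derivative_inv', derivative_C, hF', hG']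
      linear_combination -(F * G⁻¹ * R) * hGG
    · simp [div_eq_mul_inv]
  rw [← hquot, mul_assoc, hGG, mul_one]

/-- Two infinitely divisible mass functions forming a Van Dantzig pair coincide. -/
lemma IsInfDivisiblePMF.eq_of_vanDantzig {s t : ℕ → ℝ}
    (hID : IsInfDivisiblePMF s) (hIDt : IsInfDivisiblePMF t)
    (hs : ∀ n, 0 ≤ s n) (hssum : HasSum s 1) (ht : ∀ n, 0 ≤ t n) (htsum : HasSum t 1) {c : ℝ}
    (hVD : ∀ z ∈ Icc (-1 : ℝ) 1,
      (∑' n : ℕ, s n * z ^ n) * (∑' n : ℕ, t n * (-z) ^ n) = c) :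
    s = t := by
  have hs0 : 0 < s 0 := (hs 0).lt_of_ne' (hID.apply_zero_ne_zero hssum)
  have ht0 : 0 < t 0 := (ht 0).lt_of_ne' (hIDt.apply_zero_ne_zero htsum)
  have hcS : constantCoeff (mk s) = s 0 := by simp [← coeff_zero_eq_constantCoeff_apply]
  have hcT : constantCoeff (mk t) = t 0 := by simp [← coeff_zero_eq_constantCoeff_apply]
  have hSW := mk_mul_rescale_neg_one_eq_C hs hssum.summable ht htsum.summable hVD
  set W : ℝ⟦X⟧ := rescale (-1) (mk t) with hW
  have hSW0 : mk s * W ≠ 0 := by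
    intro h
    have := congrArg constantCoeff h
    rw [map_mul, hcS, hW, ← coeff_zero_eq_constantCoeff_apply, coeff_rescale] at this
    simp [hs0.ne', ht0.ne'] at this
  have hlog : ∀ u : ℕ → ℝ, u 0 ≠ 0 →
      d⁄dX ℝ (mk u) = d⁄dX ℝ (mk u) * (mk u)⁻¹ * mk u := by
    intro u hu
    rw [mul_assoc, PowerSeries.inv_mul_cancel _ (by simpa [← coeff_zero_eq_constantCoeff_apply]),
      mul_one]
  have hS' := hlog s hs0.ne'
  have hT' := hlog t ht0.ne'
  set P := d⁄dX ℝ (mk s) * (mk s)⁻¹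
  set Q := d⁄dX ℝ (mk t) * (mk t)⁻¹
  have hP := hID.coeff_nonneg_of_derivative_eq hs0 hS'
  have hQ := hIDt.coeff_nonneg_of_derivative_eq ht0 hT'
  have hW' : d⁄dX ℝ W = -(rescale (-1) Q * W) := by
    rw [hW, PowerSeries.derivative_rescale, hT', map_mul]
    simp
  have hPQ : P = rescale (-1) Q := by
    have hD := congrArg (d⁄dX ℝ) hSW
    rw [Derivation.leibniz, derivative_C, hW', hS', smul_eq_mul, smul_eq_mul] at hD
    apply mul_right_cancel₀ hSW0
    linear_combination hD
  have hPQ' : P = Q := by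
    ext n
    have hn := congrArg (coeff n) hPQ
    rw [coeff_rescale] at hn
    rcases n.even_or_odd with he | ho
    · simpa [he.neg_one_pow] using hn
    · rw [ho.neg_one_pow] at hn
      linarith [hP n, hQ n]
  have hprop := PowerSeries.eq_C_mul_of_derivative_eq (hcT ▸ ht0.ne') hS' (hPQ' ▸ hT')
  set r := constantCoeff (mk s) / constantCoeff (mk t)
  have hst : ∀ n, s n = r * t n := by
    intro n
    simpa using congrArg (coeff n) hprop
  have hr : r = 1 := by
    have := htsum.mul_left r
    rw [← funext hst, mul_one] at this
    exact this.unique hssum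
  exact funext fun n => by rw [hst, hr, one_mul]

end

/-- If `(f, g)` is a discrete Van Dantzig pair of probability
generating functions with `f ≠ g` and the mass function of `f` is infinitely
divisible, then the mass function of `g` is not infinitely divisible. -/
theorem vanDantzig_pair_not_both_infdivisible
    (s t : ℕ → ℝ) (hs : ∀ n, 0 ≤ s n) (hssum : HasSum s 1)
    (ht : ∀ n, 0 ≤ t n) (htsum : HasSum t 1)
    (hVD : ∀ z ∈ Icc (-1 : ℝ) 1,
      (∑' n : ℕ, s n * z ^ n) * (∑' n : ℕ, t n * (-z) ^ n) =
        (∑' n : ℕ, s n * (0 : ℝ) ^ n) * (∑' n : ℕ, t n * (0 : ℝ) ^ n))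
    (hne : s ≠ t)
    (hID : IsInfDivisiblePMF s) :
    ¬ IsInfDivisiblePMF t := by
  intro hIDt
  exact hne (hID.eq_of_vanDantzig hIDt hs hssum ht htsum hVD)
end
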